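/- arXiv:1405.1701 — 2 statements merged into one kernel-verified Lean document; each statement's English description precedes it below -/
import Mathlib

section
/- Let 𝓓 = (Ω, 𝓑) be a supersimple 2-(n,4,λ) design with n > 12λ + 1, let ∞ ∈ Ω, and suppose G = π_∞(𝓓) is transitive on Ω \ {∞} and preserves a system of imprimitivity with ℓ blocks each of size k. If {∞, a, b, c} is a line of 𝓓, then a, b, c are not all contained in the same block of imprimitivity. -/
open Equiv

variable {Ω : Type*} [DecidableEq Ω] [Fintype Ω]

/-- Two points of a 4-hypergraph are collinear if they are equal or some line contains both. -/
def HGCollinear (B : Finset (Finset Ω)) (x y : Ω) : Prop :=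
  x = y ∨ ∃ b ∈ B, x ∈ b ∧ y ∈ b

/-- A 4-hypergraph is pliable if any two lines sharing three pairwise distinct points are equal. -/
def HGPliable (B : Finset (Finset Ω)) : Prop :=
  ∀ b₁ ∈ B, ∀ b₂ ∈ B, ∀ p q r : Ω, p ≠ q → p ≠ r → q ≠ r →
    p ∈ b₁ → q ∈ b₁ → r ∈ b₁ → p ∈ b₂ → q ∈ b₂ → r ∈ b₂ → b₁ = b₂

/-- `g` is the elementary move `[x,y]`: it interchanges `x` and `y`, interchanges the
remaining two points of every line through `x` and `y`, and fixes everything else.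
For `x = y` it is the identity. -/
def IsElemMove (B : Finset (Finset Ω)) (x y : Ω) (g : Equiv.Perm Ω) : Prop :=
  (x = y ∧ g = 1) ∨
  (x ≠ y ∧ (∃ b ∈ B, x ∈ b ∧ y ∈ b) ∧ g x = y ∧ g y = x ∧
    ∀ z : Ω, z ≠ x → z ≠ y →
      ((∀ b ∈ B, ¬(x ∈ b ∧ y ∈ b ∧ z ∈ b)) → g z = z) ∧
      (∀ b ∈ B, x ∈ b → y ∈ b → z ∈ b →
        ∀ w ∈ b, w ≠ x → w ≠ y → w ≠ z → g z = w))

/-- `g` is the move sequence `[a₀,…,a_k]` recorded by the list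
(elementary moves applied left to right). -/
def IsMoveSeq (B : Finset (Finset Ω)) : List Ω → Equiv.Perm Ω → Prop
  | [], _ => False
  | [_], g => g = 1
  | a :: b :: l, g => ∃ e h : Equiv.Perm Ω,
      IsElemMove B a b e ∧ IsMoveSeq B (b :: l) h ∧ g = h * e

/-- The puzzle set `𝓛_𝓓` of all move sequences. -/
def puzzleSet (B : Finset (Finset Ω)) : Set (Equiv.Perm Ω) :=
  { g | ∃ l : List Ω, IsMoveSeq B l g }

/-- The hole stabiliser `π_x(𝓓)`: all closed move sequences starting and ending at `x`. -/
def holeStab (B : Finset (Finset Ω)) (x : Ω) : Set (Equiv.Perm Ω) :=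
  { g | ∃ l : List Ω, l.head? = some x ∧ l.getLast? = some x ∧ IsMoveSeq B l g }

/-- `(Ω, B)` is a 2-(n,4,λ) design: lines have four points and every pair of distinct
points lies in exactly `lam` lines. -/
def IsTwoDesign (B : Finset (Finset Ω)) (lam : ℕ) : Prop :=
  (∀ b ∈ B, b.card = 4) ∧
  ∀ p q : Ω, p ≠ q → (B.filter fun b => p ∈ b ∧ q ∈ b).card = lam

/-- Supersimple: any two distinct lines meet in at most two points. -/
def HGSupersimple (B : Finset (Finset Ω)) : Prop :=
  ∀ b₁ ∈ B, ∀ b₂ ∈ B, b₁ ≠ b₂ → (b₁ ∩ b₂).card ≤ 2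

/-- `x ∈ overline{a,c}`: `x` is `a`, `c`, or lies on a line containing both `a` and `c`. -/
def HGLineClosure (B : Finset (Finset Ω)) (a c x : Ω) : Prop :=
  x = a ∨ x = c ∨ ∃ b ∈ B, a ∈ b ∧ c ∈ b ∧ x ∈ b

/-- A system of imprimitivity for the hole stabiliser `π_x` acting on `Ω \ {x}`,
with `ℓ` blocks each of size `k`. -/
def IsHoleBlockSystem (B : Finset (Finset Ω)) (x : Ω) (P : Finset (Finset Ω))
    (k ℓ : ℕ) : Prop :=
  P.card = ℓ ∧ 1 < k ∧ 1 < ℓ ∧ (∀ Δ ∈ P, Δ.card = k) ∧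
  (∀ a : Ω, a ≠ x → ∃! Δ : Finset Ω, Δ ∈ P ∧ a ∈ Δ) ∧
  (∀ Δ ∈ P, x ∉ Δ) ∧
  (∀ g ∈ holeStab B x, ∀ Δ ∈ P, Δ.image (⇑g) ∈ P)

/-- The points other than `p` and `q` lying on a line through `p` and `q`. -/
def thirdPoints (B : Finset (Finset Ω)) (p q : Ω) : Finset Ω :=
  (B.filter fun b => p ∈ b ∧ q ∈ b).biUnion fun b => b \ {p, q}

theorem mem_thirdPoints {B : Finset (Finset Ω)} {p q z : Ω} :
    z ∈ thirdPoints B p q ↔ (∃ b ∈ B, p ∈ b ∧ q ∈ b ∧ z ∈ b) ∧ z ≠ p ∧ z ≠ q := by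
  simp only [thirdPoints, Finset.mem_biUnion, Finset.mem_filter, Finset.mem_sdiff,
    Finset.mem_insert, Finset.mem_singleton]
  grind

theorem IsTwoDesign.card_thirdPoints_le {B : Finset (Finset Ω)} {lam : ℕ}
    (hdes : IsTwoDesign B lam) {p q : Ω} (hpq : p ≠ q) :
    (thirdPoints B p q).card ≤ 2 * lam := by
  rw [← hdes.2 p q hpq, mul_comm]
  refine Finset.card_biUnion_le_card_mul _ _ _ fun b hb => ?_
  obtain ⟨hbB, hp, hq⟩ := Finset.mem_filter.1 hb
  rw [Finset.card_sdiff_of_subset (by simp [Finset.insert_subset_iff, hp, hq]), hdes.1 b hbB,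
    Finset.card_pair hpq]

theorem HGSupersimple.pliable {B : Finset (Finset Ω)} (hss : HGSupersimple B) :
    HGPliable B := by
  intro b₁ h₁ b₂ h₂ p q r hpq hpr hqr hp₁ hq₁ hr₁ hp₂ hq₂ hr₂
  by_contra hne
  have hsub : ({p, q, r} : Finset Ω) ⊆ b₁ ∩ b₂ := by
    simp [Finset.insert_subset_iff, *]
  have h3 : ({p, q, r} : Finset Ω).card = 3 := Finset.card_eq_three.2 ⟨p, q, r, hpq, hpr, hqr, rfl⟩
  have := Finset.card_le_card hsub
  have := hss b₁ h₁ b₂ h₂ hne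
  omega

theorem exists_fourth_point {b : Finset Ω} (hb : b.card = 4) {p q z : Ω} (hpq : p ≠ q)
    (hzp : z ≠ p) (hzq : z ≠ q) (hp : p ∈ b) (hq : q ∈ b) (hz : z ∈ b) :
    ∃ w ∈ b, w ≠ p ∧ w ≠ q ∧ w ≠ z ∧
      ∀ v ∈ b, v ≠ p → v ≠ q → v ≠ z → v = w := by
  have h3 : ({p, q, z} : Finset Ω).card = 3 :=
    Finset.card_eq_three.2 ⟨p, q, z, hpq, hzp.symm, hzq.symm, rfl⟩
  have h1 : (b \ {p, q, z}).card = 1 := by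
    rw [Finset.card_sdiff_of_subset (by simp [Finset.insert_subset_iff, *]), hb, h3]
  obtain ⟨w, hw⟩ := Finset.card_eq_one.1 h1
  have hmem : ∀ v, v ∈ b ∧ v ≠ p ∧ v ≠ q ∧ v ≠ z ↔ v = w := fun v => by
    simpa [not_or] using Finset.ext_iff.1 hw v
  obtain ⟨h1, h2, h3, h4⟩ := (hmem w).2 rfl
  exact ⟨w, h1, h2, h3, h4, fun v hv hvp hvq hvz => (hmem v).1 ⟨hv, hvp, hvq, hvz⟩⟩

theorem exists_isElemMove {B : Finset (Finset Ω)} (hcard : ∀ b ∈ B, b.card = 4)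
    (hpl : HGPliable B) {p q : Ω} (hpq : p ≠ q) (hcol : ∃ b ∈ B, p ∈ b ∧ q ∈ b) :
    ∃ g, IsElemMove B p q g := by
  have hstep : ∀ z, ∃ w, (z = p → w = q) ∧ (z = q → w = p) ∧ (z ≠ p → z ≠ q →
      w ≠ p ∧ w ≠ q ∧
      ((∀ b ∈ B, ¬(p ∈ b ∧ q ∈ b ∧ z ∈ b)) → w = z) ∧
      (∀ b ∈ B, p ∈ b → q ∈ b → z ∈ b → w ∈ b ∧ w ≠ z ∧
        ∀ v ∈ b, v ≠ p → v ≠ q → v ≠ z → v = w)) := by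
    intro z
    by_cases hzp : z = p
    · exact ⟨q, by grind⟩
    by_cases hzq : z = q
    · exact ⟨p, by grind⟩
    by_cases hline : ∃ b ∈ B, p ∈ b ∧ q ∈ b ∧ z ∈ b
    · obtain ⟨b, hb, hp, hq, hz⟩ := hline
      obtain ⟨w, hw, hwp, hwq, hwz, huniq⟩ :=
        exists_fourth_point (hcard b hb) hpq hzp hzq hp hq hz
      refine ⟨w, fun h => absurd h hzp, fun h => absurd h hzq, fun _ _ =>
        ⟨hwp, hwq, fun h => absurd ⟨hp, hq, hz⟩ (h b hb), fun b' hb' hp' hq' hz' => ?_⟩⟩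
      obtain rfl := hpl b hb b' hb' p q z hpq (Ne.symm hzp) (Ne.symm hzq) hp hq hz hp' hq' hz'
      exact ⟨hw, hwz, huniq⟩
    · exact ⟨z, by grind⟩
  choose f hfp hfq hf using hstep
  have hinv : Function.Involutive f := by
    intro z
    by_cases hzp : z = p
    · rw [hfp z hzp, hfq q rfl, hzp]
    by_cases hzq : z = q
    · rw [hfq z hzq, hfp p rfl, hzq]
    obtain ⟨hwp, hwq, hfix, hswap⟩ := hf z hzp hzq
    by_cases hline : ∃ b ∈ B, p ∈ b ∧ q ∈ b ∧ z ∈ b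
    · obtain ⟨b, hb, hp, hq, hz⟩ := hline
      obtain ⟨hw, hwz, -⟩ := hswap b hb hp hq hz
      exact (((hf (f z) hwp hwq).2.2.2 b hb hp hq hw).2.2 z hz hzp hzq hwz.symm).symm
    · have : f z = z := hfix fun b hb h => hline ⟨b, hb, h⟩
      rw [this, this]
  refine ⟨hinv.toPerm f, Or.inr ⟨hpq, hcol, hfp p rfl, hfq q rfl, fun z hzp hzq => ?_⟩⟩
  obtain ⟨-, -, hfix, hswap⟩ := hf z hzp hzq
  exact ⟨hfix, fun b hb hp hq hz w hw hwp hwq hwz =>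
    ((hswap b hb hp hq hz).2.2 w hw hwp hwq hwz).symm⟩

theorem IsElemMove.apply_left {B : Finset (Finset Ω)} {p q : Ω} {g : Equiv.Perm Ω}
    (hg : IsElemMove B p q g) : g p = q := by
  rcases hg with ⟨rfl, rfl⟩ | ⟨-, -, h, -⟩
  · rfl
  · exact h

theorem IsElemMove.apply_right {B : Finset (Finset Ω)} {p q : Ω} {g : Equiv.Perm Ω}
    (hg : IsElemMove B p q g) : g q = p := by
  rcases hg with ⟨rfl, rfl⟩ | ⟨-, -, -, h, -⟩
  · rfl
  · exact h

theorem IsElemMove.apply_of_notMem {B : Finset (Finset Ω)} {p q z : Ω} {g : Equiv.Perm Ω}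
    (hg : IsElemMove B p q g) (hzp : z ≠ p) (hzq : z ≠ q) (hz : z ∉ thirdPoints B p q) :
    g z = z := by
  rcases hg with ⟨-, rfl⟩ | ⟨-, -, -, -, h⟩
  · rfl
  · exact (h z hzp hzq).1 fun b hb hmem => hz (mem_thirdPoints.2 ⟨⟨b, hb, hmem⟩, hzp, hzq⟩)

theorem IsElemMove.apply_of_line {B : Finset (Finset Ω)} {p q z w : Ω} {g : Equiv.Perm Ω}
    (hg : IsElemMove B p q g) (hpq : p ≠ q) {b : Finset Ω} (hb : b ∈ B) (hp : p ∈ b) (hq : q ∈ b)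
    (hz : z ∈ b) (hw : w ∈ b) (hzp : z ≠ p) (hzq : z ≠ q) (hwp : w ≠ p) (hwq : w ≠ q)
    (hwz : w ≠ z) : g z = w := by
  rcases hg with ⟨h, -⟩ | ⟨-, -, -, -, h⟩
  · exact absurd h hpq
  · exact (h z hzp hzq).2 b hb hp hq hz w hw hwp hwq hwz

theorem mul_mem_holeStab {B : Finset (Finset Ω)} {x a d : Ω} {e₁ e₂ e₃ : Equiv.Perm Ω}
    (h₁ : IsElemMove B x a e₁) (h₂ : IsElemMove B a d e₂) (h₃ : IsElemMove B d x e₃) :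
    e₃ * e₂ * e₁ ∈ holeStab B x :=
  ⟨[x, a, d, x], rfl, rfl, e₁, e₃ * e₂, h₁, ⟨e₂, e₃, h₂, ⟨e₃, 1, h₃, rfl, rfl⟩, rfl⟩, rfl⟩

/-- If `{x, a, b, c}` is a line and `d` is collinear with no two of `x, a, c`, then the closed
move sequence `[x, a, d, x]` maps `a` to `d` and `b` to `c`. -/
theorem exists_holeStab_apply_eq {B : Finset (Finset Ω)} {lam : ℕ} (hlam : 0 < lam)
    (hdes : IsTwoDesign B lam) (hpl : HGPliable B) {x a b c d : Ω} {α : Finset Ω}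
    (hα : α ∈ B) (hxα : x ∈ α) (haα : a ∈ α) (hbα : b ∈ α) (hcα : c ∈ α)
    (hax : a ≠ x) (hbx : b ≠ x) (hcx : c ≠ x) (hab : a ≠ b) (hac : a ≠ c) (hbc : b ≠ c)
    (hdx : d ≠ x) (hda : d ≠ a) (hdc : d ≠ c) (h₁ : d ∉ thirdPoints B x a)
    (h₂ : d ∉ thirdPoints B a c) (h₃ : d ∉ thirdPoints B x c) :
    ∃ g ∈ holeStab B x, g a = d ∧ g b = c := by
  have hmove : ∀ p q, p ≠ q → ∃ e, IsElemMove B p q e := fun p q hpq => by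
    refine exists_isElemMove hdes.1 hpl hpq ?_
    obtain ⟨b, hb⟩ := Finset.card_pos.1 (hdes.2 p q hpq ▸ hlam)
    exact ⟨b, Finset.mem_filter.1 hb⟩
  obtain ⟨e₁, he₁⟩ := hmove x a hax.symm
  obtain ⟨e₂, he₂⟩ := hmove a d hda.symm
  obtain ⟨e₃, he₃⟩ := hmove d x hdx
  refine ⟨e₃ * e₂ * e₁, mul_mem_holeStab he₁ he₂ he₃, ?_, ?_⟩
  · rw [Equiv.Perm.mul_apply, Equiv.Perm.mul_apply, he₁.apply_right,
      he₂.apply_of_notMem hax.symm hdx.symm, he₃.apply_right]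
    rw [mem_thirdPoints] at h₁ ⊢
    grind
  · rw [Equiv.Perm.mul_apply, Equiv.Perm.mul_apply,
      he₁.apply_of_line hax.symm hα hxα haα hbα hcα hbx hab.symm hcx hac.symm hbc.symm,
      he₂.apply_of_notMem hac.symm hdc.symm, he₃.apply_of_notMem hdc.symm hcx]
    · rw [mem_thirdPoints] at h₃ ⊢
      grind
    · rw [mem_thirdPoints] at h₂ ⊢
      grind

theorem IsHoleBlockSystem.two_mul_lt_card {B : Finset (Finset Ω)} {x : Ω}
    {P : Finset (Finset Ω)} {k ℓ : ℕ} (hP : IsHoleBlockSystem B x P k ℓ) :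
    2 * k < Fintype.card Ω := by
  obtain ⟨rfl, -, hℓ, hk, huniq, hx, -⟩ := hP
  obtain ⟨Δ, hΔ, Δ', hΔ', hne⟩ := Finset.one_lt_card.1 hℓ
  have hdisj : Disjoint Δ Δ' := Finset.disjoint_left.2 fun y hy hy' =>
    hne ((huniq y fun h => hx Δ hΔ (h ▸ hy)).unique ⟨hΔ, hy⟩ ⟨hΔ', hy'⟩)
  have hcard := Finset.card_lt_univ_of_notMem (s := Δ ∪ Δ') (x := x)
    (by simp [hx Δ hΔ, hx Δ' hΔ'])
  rw [Finset.card_union_of_disjoint hdisj, hk Δ hΔ, hk Δ' hΔ'] at hcard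
  omega

/-- (Lemma 5.5) If `n > 12λ + 1` and the hole stabilizer is transitive
and preserves a system of imprimitivity, then for any line `{∞,a,b,c}` of the design the
points `a, b, c` are not all contained in one block of imprimitivity. -/
theorem stmt11 (B : Finset (Finset Ω)) (n lam : ℕ) (hn : Fintype.card Ω = n)
    (hlam : 0 < lam) (hdes : IsTwoDesign B lam) (hss : HGSupersimple B)
    (hbig : 12 * lam + 1 < n) (x : Ω)
    (htrans : ∀ a b : Ω, a ≠ x → b ≠ x → ∃ g ∈ holeStab B x, g a = b)
    (P : Finset (Finset Ω)) (k ℓ : ℕ) (hP : IsHoleBlockSystem B x P k ℓ) :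
    ∀ α ∈ B, x ∈ α → ∀ Δ ∈ P, ¬ (∀ p ∈ α, p ≠ x → p ∈ Δ) := by
  intro α hα hxα Δ hΔ hsub
  have hk2 := hP.two_mul_lt_card
  obtain ⟨-, -, -, hk, huniq, hx, hinv⟩ := hP
  have hcard : (α.erase x).card = 3 := by rw [Finset.card_erase_of_mem hxα, hdes.1 α hα]
  obtain ⟨a, b, c, hab, hac, hbc, habc⟩ := Finset.card_eq_three.1 hcard
  have hmem : ∀ p, p ∈ ({a, b, c} : Finset Ω) → p ≠ x ∧ p ∈ α := fun p hp =>
    Finset.mem_erase.1 (habc ▸ hp)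
  obtain ⟨hax, haα⟩ := hmem a (by simp)
  obtain ⟨hbx, hbα⟩ := hmem b (by simp)
  obtain ⟨hcx, hcα⟩ := hmem c (by simp)
  have haΔ := hsub a haα hax
  have hbΔ := hsub b hbα hbx
  have hcΔ := hsub c hcα hcx
  have hcover : (insert x Δ)ᶜ ⊆ thirdPoints B x a ∪ thirdPoints B a c ∪ thirdPoints B x c := by
    intro d hd
    obtain ⟨hdx, hdΔ⟩ : d ≠ x ∧ d ∉ Δ := by simpa [not_or] using hd
    by_contra hnot
    simp only [Finset.mem_union, not_or] at hnot
    obtain ⟨⟨h₁, h₂⟩, h₃⟩ := hnot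
    obtain ⟨g, hg, hga, hgb⟩ := exists_holeStab_apply_eq hlam hdes hss.pliable hα hxα haα hbα hcα
      hax hbx hcx hab hac hbc hdx (fun h => hdΔ (h ▸ haΔ)) (fun h => hdΔ (h ▸ hcΔ)) h₁ h₂ h₃
    have himage : Δ.image g = Δ := (huniq c hcx).unique
      ⟨hinv g hg Δ hΔ, Finset.mem_image.2 ⟨b, hbΔ, hgb⟩⟩ ⟨hΔ, hcΔ⟩
    exact hdΔ (himage ▸ Finset.mem_image.2 ⟨a, haΔ, hga⟩)
  have hle := Finset.card_le_card hcover
  rw [Finset.card_compl, Finset.card_insert_of_notMem (hx Δ hΔ), hk Δ hΔ] at hle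
  have hu₁ := Finset.card_union_le (thirdPoints B x a ∪ thirdPoints B a c) (thirdPoints B x c)
  have hu₂ := Finset.card_union_le (thirdPoints B x a) (thirdPoints B a c)
  have h₁ := hdes.card_thirdPoints_le hax.symm
  have h₂ := hdes.card_thirdPoints_le hac
  have h₃ := hdes.card_thirdPoints_le hcx.symm
  omega
end

section
/- Let 𝓓 = (Ω, 𝓑) be a supersimple 2-(n,4,2) design, ∞ ∈ Ω, and suppose G = π_∞(𝓓) is transitive on Ω \ {∞} and preserves a system of imprimitivity with ℓ blocks each of size k. Then k ≠ 3. -/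
open Equiv

variable {Ω : Type*} [DecidableEq Ω] [Fintype Ω]

/-- The combinatorial data carried by a supersimple `2-(n,4,2)` design with a hole `o` whose hole
stabilizer preserves a partition of the remaining points into triples: `Q` is the relation of
being the four points of a line, `M x y` is the elementary move `[x,y]`, and `R` is the relation
of lying in a common triple. -/
structure TripleBlockData (α : Type*) (o : α) where
  Q : α → α → α → α → Prop
  M : α → α → α → α
  R : α → α → Prop
  swap₁₂ : ∀ {x y z w}, Q x y z w → Q y x z w
  swap₂₃ : ∀ {x y z w}, Q x y z w → Q x z y w
  swap₃₄ : ∀ {x y z w}, Q x y z w → Q x y w z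
  ne : ∀ {x y z w}, Q x y z w → x ≠ y
  unique : ∀ {x y z w w'}, Q x y z w → Q x y z w' → w = w'
  lines : ∀ {x y}, x ≠ y → ∃ x₁ y₁ x₂ y₂, Q x y x₁ y₁ ∧ Q x y x₂ y₂ ∧
    x₁ ≠ x₂ ∧ x₁ ≠ y₂ ∧ y₁ ≠ x₂ ∧ y₁ ≠ y₂ ∧
    ∀ z w, Q x y z w → z = x₁ ∨ z = y₁ ∨ z = x₂ ∨ z = y₂
  M_left : ∀ {x y}, x ≠ y → M x y x = y
  M_right : ∀ {x y}, x ≠ y → M x y y = x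
  M_line : ∀ {x y z w}, Q x y z w → M x y z = w
  M_fix : ∀ {x y z}, x ≠ y → z ≠ x → z ≠ y → (∀ w, ¬ Q x y z w) → M x y z = z
  M_injective : ∀ {x y}, x ≠ y → Function.Injective (M x y)
  R_refl : ∀ {x}, x ≠ o → R x x
  R_symm : ∀ {x y}, R x y → R y x
  R_trans : ∀ {x y z}, R x y → R y z → R x z
  R_ne : ∀ {x y}, R x y → x ≠ o
  block : ∀ {x}, x ≠ o → ∃ y z, x ≠ y ∧ x ≠ z ∧ y ≠ z ∧ R x y ∧ R x z ∧
    ∀ w, R x w → w = x ∨ w = y ∨ w = z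
  R_move : ∀ {a b}, a ≠ o → b ≠ o → a ≠ b → ∀ {y z}, R y z →
    R (M b o (M a b (M o a y))) (M b o (M a b (M o a z)))

namespace TripleBlockData

variable {α : Type*} {o : α} (D : TripleBlockData α o)

/-- The closed move sequence `[o,a,b,o]`. -/
def loop (a b z : α) : α := D.M b o (D.M a b (D.M o a z))

include D

lemma Q_ne_all {x y z w : α} (h : D.Q x y z w) :
    x ≠ y ∧ x ≠ z ∧ x ≠ w ∧ y ≠ z ∧ y ≠ w ∧ z ≠ w := by
  have h1 := D.ne h
  have h2 := D.ne (D.swap₂₃ h)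
  have h3 := D.ne (D.swap₂₃ (D.swap₃₄ h))
  have h4 := D.ne (D.swap₂₃ (D.swap₁₂ h))
  have h5 := D.ne (D.swap₂₃ (D.swap₃₄ (D.swap₁₂ h)))
  have h6 := D.ne (D.swap₁₂ (D.swap₂₃ (D.swap₃₄ (D.swap₁₂ (D.swap₂₃ h)))))
  grind

lemma loop_injective {a b : α} (ha : a ≠ o) (hb : b ≠ o) (hab : a ≠ b) :
    Function.Injective (D.loop a b) :=
  (D.M_injective hb).comp ((D.M_injective hab).comp (D.M_injective ha.symm))

lemma R_loop {a b y z : α} (ha : a ≠ o) (hb : b ≠ o) (hab : a ≠ b) (h : D.R y z) :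
    D.R (D.loop a b y) (D.loop a b z) := D.R_move ha hb hab h

/-- A triple is determined by any three of its points. -/
lemma block_eq {a b c z : α} (hab : D.R a b) (hac : D.R a c) (h1 : a ≠ b) (h2 : a ≠ c)
    (h3 : b ≠ c) (hz : D.R a z) : z = a ∨ z = b ∨ z = c := by
  obtain ⟨y, w, -, -, -, -, -, h⟩ := D.block (D.R_ne hab)
  grind

lemma loop_swap {a b : α} (ha : a ≠ o) (hb : b ≠ o) (hab : a ≠ b)
    (h : ∀ w, ¬ D.Q o a b w) : D.loop a b a = b := by
  have h1 : D.M o a a = o := D.M_right ha.symm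
  have h2 : D.M a b o = o := by
    refine D.M_fix hab ha.symm hb.symm fun w hw => h w ?_
    exact D.swap₁₂ (D.swap₂₃ hw)
  have h3 : D.M b o o = b := D.M_right hb
  simp [loop, h1, h2, h3]

lemma loop_swap' {a b : α} (ha : a ≠ o) (hb : b ≠ o) (hab : a ≠ b)
    (h : ∀ w, ¬ D.Q o a b w) : D.loop a b b = a := by
  have h1 : D.M o a b = b := D.M_fix ha.symm hb hab.symm h
  have h2 : D.M a b b = a := D.M_right hab
  have h3 : D.M b o a = a :=
    D.M_fix hb hab ha fun w hw => h w (D.swap₂₃ (D.swap₁₂ hw))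
  simp [loop, h1, h2, h3]

lemma R_loop_of_not_collinear {a b z : α} (hb : b ≠ o) (hab : a ≠ b)
    (h : ∀ w, ¬ D.Q o a b w) (hz : D.R a z) : D.R b (D.loop a b z) := by
  have ha := D.R_ne hz
  have := D.R_loop ha hb hab hz
  rwa [D.loop_swap ha hb hab h] at this

lemma loop_third {a b c : α} (h : ∀ w, ¬ D.Q o a b w) (hab : D.R a b) (hac : D.R a c)
    (h1 : a ≠ b) (h2 : a ≠ c) (h3 : b ≠ c) : D.loop a b c = c := by
  have ha := D.R_ne hab
  have hb := D.R_ne (D.R_symm hab)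
  have hr := D.R_trans hab (D.R_loop_of_not_collinear hb h1 h hac)
  have hi := D.loop_injective ha hb h1
  have e1 := D.loop_swap ha hb h1 h
  have e2 := D.loop_swap' ha hb h1 h
  rcases D.block_eq hab hac h1 h2 h3 hr with h' | h' | h'
  · exact absurd (hi (h'.trans e2.symm)) h3.symm
  · exact absurd (hi (h'.trans e1.symm)) h2.symm
  · exact h'

lemma loop_left {a b c : α} (h : D.Q o a b c) : D.loop a b a = a := by
  have h0 := D.Q_ne_all h
  have h1 : D.M o a a = o := D.M_right h0.1
  have h2 : D.M a b o = c := D.M_line (D.swap₂₃ (D.swap₁₂ h))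
  have h3 : D.M b o c = a :=
    D.M_line (D.swap₃₄ (D.swap₁₂ (D.swap₂₃ h)))
  simp [loop, h1, h2, h3]

lemma loop_right {a b c : α} (h : D.Q o a b c) : D.loop a b b = b := by
  have h0 := D.Q_ne_all h
  have h1 : D.M o a b = c := D.M_line h
  have h2 : D.M a b c = o :=
    D.M_line (D.swap₃₄ (D.swap₂₃ (D.swap₁₂ h)))
  have h3 : D.M b o o = b := D.M_right h0.2.1.symm
  simp [loop, h1, h2, h3]

lemma loop_last {a b c : α} (h : D.Q o a b c) : D.loop a b c = c := by
  have h0 := D.Q_ne_all h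
  have h1 : D.M o a c = b := D.M_line (D.swap₃₄ h)
  have h2 : D.M a b b = a := D.M_right h0.2.2.2.1
  have h3 : D.M b o a = c := D.M_line (D.swap₁₂ (D.swap₂₃ h))
  simp [loop, h1, h2, h3]

/-- Evaluation of an elementary move on a point other than the two it interchanges. -/
lemma M_cases {x y z : α} (h : x ≠ y) (hx : z ≠ x) (hy : z ≠ y) :
    D.Q x y z (D.M x y z) ∨ (∀ w, ¬ D.Q x y z w) ∧ D.M x y z = z := by
  by_cases hq : ∃ w, D.Q x y z w
  · obtain ⟨w, hw⟩ := hq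
    rw [D.M_line hw]
    exact Or.inl hw
  · push Not at hq
    exact Or.inr ⟨hq, D.M_fix h hx hy hq⟩

lemma loop_fix {a b c z : α} (h : D.Q o a b c) (haz : D.R a z) {d : α} (had : D.R a d)
    (hd : D.loop a b d = d) (h1 : a ≠ z) (h2 : a ≠ d) (h3 : d ≠ z) : D.loop a b z = z := by
  have h0 := D.Q_ne_all h
  have hr := D.R_loop (D.R_ne haz) h0.2.1.symm h0.2.2.2.1 haz
  have e := D.loop_left h
  rw [e] at hr
  have hi := D.loop_injective (D.R_ne haz) h0.2.1.symm h0.2.2.2.1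
  rcases D.block_eq haz had h1 h2 h3.symm hr with h' | h' | h'
  · exact absurd (hi (h'.trans e.symm)) h1.symm
  · exact h'
  · exact absurd (hi (h'.trans hd.symm)) h3.symm

/-- If two points of a triple are collinear with the hole, then the third point is either on
no line with two of these three points, or all three pairs are collinear with the hole in a
triangular configuration. -/
lemma triangle_or {a a' a'' p : α} (h : D.Q o a a' p) (h1 : D.R a a') (h2 : D.R a a'')
    (n1 : a ≠ a'') (n2 : a' ≠ a'') (hp : p ≠ a'') :
    (∃ y v, D.Q o a a'' y ∧ D.Q a a' y v ∧ D.Q o a' a'' v) ∨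
    ((∀ w, ¬ D.Q o a a'' w) ∧ (∀ w, ¬ D.Q a a' a'' w) ∧ (∀ w, ¬ D.Q o a' a'' w)) := by
  have h0 := D.Q_ne_all h
  have ho := D.R_ne (D.R_symm h2)
  have hf := D.loop_fix h h2 h1 (D.loop_right h) n1 h0.2.2.2.1 n2
  rcases D.M_cases h0.1 ho n1.symm with hz1 | ⟨hz1, e1⟩
  · left
    set y := D.M o a a'' with hy
    have hy0 := D.Q_ne_all hz1
    have y1 : y ≠ a' := by
      intro e; rw [e] at hz1
      exact hp (D.unique h (D.swap₃₄ hz1))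
    have hl : D.M a' o (D.M a a' y) = a'' := hf
    rcases D.M_cases h0.2.2.2.1 hy0.2.2.2.2.1.symm y1 with hz2 | ⟨hz2, e2⟩
    · set v := D.M a a' y with hv
      have hv0 := D.Q_ne_all hz2
      have v1 : v ≠ o := by
        intro e; rw [e] at hz2
        have e3 : D.Q o a a' y := D.swap₁₂ (D.swap₂₃ (D.swap₃₄ hz2))
        have := D.unique h e3
        subst this
        exact n2 (D.unique (D.swap₃₄ h) (D.swap₃₄ hz1))
      have v2 : v ≠ a'' := by
        intro e; rw [e] at hz2
        have e3 : D.Q a a'' y a' := D.swap₃₄ (D.swap₂₃ (D.swap₃₄ hz2))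
        have e4 : D.Q a a'' y o := D.swap₃₄ (D.swap₂₃ (D.swap₁₂ hz1))
        exact h0.2.1 (D.unique e4 e3)
      rcases D.M_cases h0.2.1.symm hv0.2.2.2.2.1.symm v1 with hz3 | ⟨_, e3⟩
      · rw [hl] at hz3
        exact ⟨y, v, hz1, hz2, D.swap₁₂ (D.swap₃₄ hz3)⟩
      · rw [hl] at e3
        exact absurd e3.symm v2
    · rw [e2] at hl
      rcases D.M_cases h0.2.1.symm y1 hy0.2.2.1.symm with hz3 | ⟨_, e3⟩
      · rw [hl] at hz3
        have e3 : D.Q o a'' y a' := D.swap₂₃ (D.swap₃₄ (D.swap₂₃ (D.swap₁₂ hz3)))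
        have e4 : D.Q o a'' y a := D.swap₃₄ (D.swap₂₃ hz1)
        exact absurd (D.unique e4 e3) h0.2.2.2.1
      · rw [hl] at e3
        exact absurd e3 hy0.2.2.2.2.2
  · right
    have hl : D.M a' o (D.M a a' a'') = a'' := by rw [loop, e1] at hf; exact hf
    rcases D.M_cases h0.2.2.2.1 n1.symm n2.symm with hz2 | ⟨hz2, e2⟩
    · exfalso
      set v := D.M a a' a'' with hv
      have hv0 := D.Q_ne_all hz2
      have v1 : v ≠ o := by
        intro e; rw [e] at hz2
        exact hz1 a' (D.swap₃₄ (D.swap₁₂ (D.swap₂₃ (D.swap₃₄ hz2))))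
      rcases D.M_cases h0.2.1.symm hv0.2.2.2.2.1.symm v1 with hz3 | ⟨_, e3⟩
      · rw [hl] at hz3
        have e3 : D.Q a' a'' v o := D.swap₂₃ (D.swap₃₄ (D.swap₂₃ hz3))
        have e4 : D.Q a' a'' v a := D.swap₃₄ (D.swap₂₃ (D.swap₁₂ hz2))
        exact h0.1 (D.unique e3 e4)
      · rw [hl] at e3
        exact hv0.2.2.2.2.2 e3
    · refine ⟨hz1, hz2, fun w hw => ?_⟩
      rw [e2, D.M_line (D.swap₁₂ hw)] at hl
      exact (D.Q_ne_all hw).2.2.2.2.2 hl.symm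

/-- Every line through two points is complemented by a second one. -/
lemma exists_second_line {x y p q : α} (h : D.Q x y p q) :
    ∃ r s, D.Q x y r s ∧ p ≠ r ∧ p ≠ s ∧ q ≠ r ∧ q ≠ s ∧
      ∀ z w, D.Q x y z w → z = p ∨ z = q ∨ z = r ∨ z = s := by
  obtain ⟨x₁, y₁, x₂, y₂, h1, h2, n1, n2, n3, n4, hall⟩ := D.lines (D.ne h)
  have s1 := D.swap₃₄ h1
  have s2 := D.swap₃₄ h2
  rcases hall p q h with e | e | e | e
  · subst e
    obtain rfl := D.unique h h1
    exact ⟨x₂, y₂, h2, n1, n2, n3, n4, hall⟩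
  · subst e
    obtain rfl := D.unique h s1
    exact ⟨x₂, y₂, h2, n3, n4, n1, n2, fun z w hw => by grind⟩
  · subst e
    obtain rfl := D.unique h h2
    exact ⟨x₁, y₁, h1, n1.symm, n3.symm, n2.symm, n4.symm, fun z w hw => by grind⟩
  · subst e
    obtain rfl := D.unique h s2
    exact ⟨x₁, y₁, h1, n2.symm, n4.symm, n1.symm, n3.symm, fun z w hw => by grind⟩

lemma mem_of_two_lines {x y p q r s z w : α} (h1 : D.Q x y p q) (h2 : D.Q x y r s)
    (hpr : p ≠ r) (hps : p ≠ s) (h : D.Q x y z w) : z = p ∨ z = q ∨ z = r ∨ z = s := by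
  obtain ⟨r', s', h3, n1, n2, n3, n4, hall⟩ := D.exists_second_line h1
  have hu1 := @D.unique x y r s s'
  have hu2 := @D.unique x y r s r' h2
  have h3' := D.swap₃₄ h3
  have := hall r s h2
  have hz := hall z w h
  have h1' := D.swap₃₄ h1
  have hu3 := @D.unique x y r s p h2
  grind

lemma triangle_block {a a' a'' p y v : α} (h : D.Q o a a' p) (h1 : D.R a a') (h2 : D.R a a'')
    (n1 : a ≠ a'') (n2 : a' ≠ a'') (hp : p ≠ a'')
    (hy : D.Q o a a'' y) (hv : D.Q o a' a'' v) (hyv : D.Q a a' y v) (hpR : ¬ D.R a p)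
    (hyR : ¬ D.R a y) : D.R y v := by
  have h0 := D.Q_ne_all h
  have hy0 := D.Q_ne_all hy
  have hv0 := D.Q_ne_all hv
  have hyv0 := D.Q_ne_all hyv
  have py : p ≠ y := by
    rintro rfl
    exact n2 (D.unique (D.swap₃₄ h) (D.swap₃₄ hy))
  have pv : p ≠ v := by
    rintro rfl
    exact n1 (D.unique (D.swap₃₄ (D.swap₂₃ h)) (D.swap₃₄ hv))
  have na : ∀ z w, D.Q o a z w → z = a' ∨ z = p ∨ z = a'' ∨ z = y :=
    fun z w => D.mem_of_two_lines h hy n2 hyv0.2.2.2.1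
  have na' : ∀ z w, D.Q a' o z w → z = a ∨ z = p ∨ z = a'' ∨ z = v :=
    fun z w => D.mem_of_two_lines (D.swap₁₂ (D.swap₂₃ h)) (D.swap₁₂ hv) n1 hyv0.2.2.1
  have naa' : ∀ z w, D.Q a a' z w → z = o ∨ z = p ∨ z = y ∨ z = v :=
    fun z w => D.mem_of_two_lines (D.swap₂₃ (D.swap₁₂ h)) hyv hy0.2.2.1 hv0.2.2.1
  have gp := D.loop_last h
  have gy : D.loop a a' y = v := by
    have e1 : D.M o a y = a'' := D.M_line (D.swap₃₄ hy)
    have e2 : D.M a a' a'' = a'' :=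
      D.M_fix h0.2.2.2.1 n1.symm n2.symm fun w hw => by grind
    have e3 : D.M a' o a'' = v := D.M_line (D.swap₁₂ hv)
    simp [loop, e1, e2, e3]
  by_contra hR
  obtain ⟨t, s, yt, ys, ts, Rt, Rs, -⟩ := D.block hy0.2.2.1.symm
  have tv : t ≠ v := by rintro rfl; exact hR Rt
  have hto := D.R_ne (D.R_symm Rt)
  have ta : t ≠ a := by rintro rfl; exact hyR (D.R_symm Rt)
  have ta' : t ≠ a' := by rintro rfl; exact hyR (D.R_trans h1 (D.R_symm Rt))
  have ta'' : t ≠ a'' := by rintro rfl; exact hyR (D.R_trans h2 (D.R_symm Rt))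
  have gt : D.loop a a' t = t := by
    by_cases tp : t = p
    · rw [tp, gp]
    have e1 : D.M o a t = t := D.M_fix h0.1 hto ta fun w hw => by grind
    have e2 : D.M a a' t = t := D.M_fix h0.2.2.2.1 ta ta' fun w hw => by grind
    have e3 : D.M a' o t = t := D.M_fix h0.2.1.symm ta' hto fun w hw => by grind
    simp [loop, e1, e2, e3]
  have := D.R_loop h0.1.symm h0.2.1.symm h0.2.2.2.1 Rt
  rw [gy, gt] at this
  exact hR (D.R_trans Rt (D.R_symm this))

omit D in
lemma exists_notMem_of_card [Fintype α] (l : List α) (h : l.length < Fintype.card α) :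
    ∃ b, b ∉ l := by
  classical
  by_contra! hl
  have : Fintype.card α ≤ l.toFinset.card := by
    rw [← Finset.card_univ]
    exact Finset.card_le_card fun b _ => by simpa using hl b
  exact absurd (this.trans l.toFinset_card_le) (by omega)

/-- With more than seven points, two points of a triple which are collinear with the hole
have their third point on the line as well. -/
lemma third_mem_line [Fintype α] (hn : 10 ≤ Fintype.card α) {a a' a'' p : α}
    (h : D.Q o a a' p) (h1 : D.R a a') (h2 : D.R a a'') (n1 : a ≠ a'') (n2 : a' ≠ a'') :
    p = a'' := by
  by_contra hp
  have h0 := D.Q_ne_all h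
  have ho := D.R_ne (D.R_symm h2)
  have hpR : ¬ D.R a p := by
    intro hR
    have := D.block_eq h1 h2 h0.2.2.2.1 n1 n2 hR
    grind
  rcases D.triangle_or h h1 h2 n1 n2 hp with ⟨y, v, hy, hyv, hv⟩ | ⟨k1, k2, k3⟩
  · have hy0 := D.Q_ne_all hy
    have hv0 := D.Q_ne_all hv
    have hyv0 := D.Q_ne_all hyv
    have hyR : ¬ D.R a y := by
      intro hR
      have := D.block_eq h1 h2 h0.2.2.2.1 n1 n2 hR
      grind
    obtain ⟨p', v', e1, e2, e3⟩ : ∃ p' v', D.Q o a a' p' ∧ D.Q a a'' p' v' ∧ D.Q o a'' a' v' := by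
      rcases D.triangle_or hy h2 h1 h0.2.2.2.1 n2.symm hyv0.2.2.2.1.symm with h' | h'
      · exact h'
      · exact absurd h (h'.1 p)
    obtain rfl := D.unique h e1
    obtain rfl := D.unique hv (D.swap₂₃ e3)
    have r1 := D.triangle_block h h1 h2 n1 n2 hp hy hv hyv hpR hyR
    have r2 := D.triangle_block hy h2 h1 h0.2.2.2.1 n2.symm hyv0.2.2.2.1.symm h e3 e2 hyR hpR
    have pv := (D.Q_ne_all e2).2.2.2.2.2
    have py : p ≠ y := by
      rintro rfl
      exact n2 (D.unique (D.swap₃₄ h) (D.swap₃₄ hy))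
    obtain ⟨r, s, hrs, m1, m2, m3, m4, hall⟩ :=
      D.exists_second_line (D.swap₂₃ (D.swap₃₄ h))
    obtain ⟨b, hb⟩ := exists_notMem_of_card [o, a, a', a'', p, y, v, r, s] (by simp; omega)
    simp only [List.mem_cons, List.not_mem_nil, or_false, not_or] at hb
    obtain ⟨b1, b2, b3, b4, b5, b6, b7, b8, b9⟩ := hb
    have nb : ∀ w, ¬ D.Q o a b w := fun w hw => by
      have := D.mem_of_two_lines h hy n2 hyv0.2.2.2.1 hw
      grind
    have key := D.R_loop_of_not_collinear b1 (Ne.symm b2) nb h1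
    have e4 : D.M o a a' = p := D.M_line h
    have e5 : D.M a b p = p := by
      refine D.M_fix (Ne.symm b2) h0.2.2.2.2.1.symm (Ne.symm b5) fun w hw => ?_
      have f1 : D.Q a p o a' := D.swap₂₃ (D.swap₁₂ (D.swap₃₄ h))
      have := D.mem_of_two_lines f1 (D.swap₂₃ e2) (Ne.symm ho) hv0.2.2.1 (D.swap₂₃ hw)
      grind
    have e6 : D.M b o p = p := by
      refine D.M_fix b1 (Ne.symm b5) h0.2.2.1.symm fun w hw => ?_
      have := hall b w (D.swap₂₃ (D.swap₁₂ hw))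
      grind
    simp only [loop, e4, e5, e6] at key
    have := D.block_eq r2 (D.R_trans r2 (D.R_symm r1)) pv py hyv0.2.2.2.2.2.symm (D.R_symm key)
    grind
  · have hf := D.loop_fix (D.swap₃₄ h) h2 h1 (D.loop_last (D.swap₃₄ h)) n1 h0.2.2.2.1 n2
    have e1 : D.M o a a'' = a'' := D.M_fix h0.1 ho n1.symm k1
    have k4 : ∀ w, ¬ D.Q a p a'' w := by
      intro t ht
      have t0 := D.Q_ne_all ht
      have e2 : D.M a p a'' = t := D.M_line ht
      rw [loop, e1, e2] at hf
      have t1 : t ≠ o := by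
        rintro rfl
        exact k1 p (D.swap₃₄ (D.swap₁₂ (D.swap₂₃ (D.swap₃₄ ht))))
      rcases D.M_cases h0.2.2.1.symm t0.2.2.2.2.1.symm t1 with hz | ⟨_, e3⟩
      · rw [hf] at hz
        have f1 : D.Q p a'' t o := D.swap₂₃ (D.swap₃₄ (D.swap₂₃ hz))
        have f2 : D.Q p a'' t a := D.swap₃₄ (D.swap₂₃ (D.swap₁₂ ht))
        exact h0.1 (D.unique f1 f2)
      · rw [hf] at e3
        exact t0.2.2.2.2.2 e3
    have e2 : D.M a p a'' = a'' := D.M_fix h0.2.2.2.2.1 n1.symm (Ne.symm hp) k4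
    have k5 : ∀ w, ¬ D.Q p o a'' w := by
      intro w hw
      rw [loop, e1, e2, D.M_line hw] at hf
      exact (D.Q_ne_all hw).2.2.2.2.2 hf.symm
    have hg := D.loop_third k1 h2 h1 n1 h0.2.2.2.1 n2.symm
    have f1 : D.M o a a' = p := D.M_line h
    have f2 : D.M a a'' p = p :=
      D.M_fix n1 h0.2.2.2.2.1.symm hp fun w hw => k4 w (D.swap₂₃ hw)
    have f3 : D.M a'' o p = p := D.M_fix ho hp h0.2.2.1.symm fun w hw =>
      k5 w (D.swap₂₃ (D.swap₁₂ (D.swap₂₃ hw)))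
    rw [loop, f1, f2, f3] at hg
    exact h0.2.2.2.2.2 hg.symm

lemma cover_of_line {a a' a'' b c d u v i j : α} (h : D.Q o a a' a'') (h1 : D.R a a')
    (h2 : D.R a a'') (hN : D.Q o a c d) (hE : D.Q a a'' u v) (hN' : D.Q o a'' i j)
    (hac : a' ≠ c) (had : a' ≠ d) (hou : o ≠ u) (hov : o ≠ v) (hai : a ≠ i) (haj : a ≠ j) :
    b ∈ [o, a, a', a'', c, d, u, v, i, j] := by
  by_contra hb
  simp only [List.mem_cons, List.not_mem_nil, or_false, not_or] at hb
  obtain ⟨b1, b2, b3, b4, b5, b6, b7, b8, b9, b10⟩ := hb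
  have h0 := D.Q_ne_all h
  have nb : ∀ w, ¬ D.Q o a b w := fun w hw => by
    have := D.mem_of_two_lines h hN hac had hw
    grind
  have key := D.R_loop_of_not_collinear b1 (Ne.symm b2) nb h1
  have e1 : D.M o a a' = a'' := D.M_line h
  have e2 : D.M a b a'' = a'' := by
    refine D.M_fix (Ne.symm b2) h0.2.2.2.2.1.symm (Ne.symm b4) fun w hw => ?_
    have f : D.Q a a'' o a' := D.swap₂₃ (D.swap₁₂ (D.swap₃₄ h))
    have := D.mem_of_two_lines f hE hou hov (D.swap₂₃ hw)
    grind
  have e3 : D.M b o a'' = a'' := by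
    refine D.M_fix b1 (Ne.symm b4) h0.2.2.1.symm fun w hw => ?_
    have f : D.Q o a'' a a' := D.swap₂₃ (D.swap₃₄ h)
    have := D.mem_of_two_lines f hN' hai haj (D.swap₂₃ (D.swap₁₂ hw))
    grind
  simp only [loop, e1, e2, e3] at key
  have := D.block_eq h1 h2 h0.2.2.2.1 h0.2.2.2.2.1 h0.2.2.2.2.2
    (D.R_trans h2 (D.R_symm key))
  grind

omit D in
lemma nodup_of_card [Fintype α] {l : List α} (h : l.length ≤ Fintype.card α)
    (hl : ∀ b, b ∈ l) : l.Nodup := by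
  classical
  have h1 : l.toFinset = Finset.univ := by ext; simp [hl]
  have h2 : l.toFinset.card = l.dedup.length := List.card_toFinset l
  rw [h1, Finset.card_univ] at h2
  exact List.dedup_eq_self.1 (l.dedup_sublist.eq_of_length_le (h2 ▸ h))

/-- With more than seven points, no triple together with the hole is a line. -/
lemma not_line_block [Fintype α] (hn : 10 ≤ Fintype.card α) {a a' a'' : α}
    (h : D.Q o a a' a'') (h1 : D.R a a') (h2 : D.R a a'') : False := by
  have h0 := D.Q_ne_all h
  have p1 : D.Q o a'' a a' := D.swap₂₃ (D.swap₃₄ h)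
  have p2 : D.Q o a' a a'' := D.swap₂₃ h
  obtain ⟨c, d, hN, c1, c2, c3, c4, -⟩ := D.exists_second_line h
  obtain ⟨e, f, hN', e1, e2, e3, e4, -⟩ := D.exists_second_line p2
  obtain ⟨i, j, hN'', i1, i2, i3, i4, -⟩ := D.exists_second_line p1
  obtain ⟨u, v, hE, u1, u2, -, -, -⟩ :=
    D.exists_second_line (D.swap₂₃ (D.swap₁₂ (D.swap₃₄ h)))
  obtain ⟨u', v', hE', u1', u2', -, -, -⟩ := D.exists_second_line (D.swap₂₃ (D.swap₁₂ h))
  obtain ⟨x, y, hF, x1, x2, -, -, -⟩ :=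
    D.exists_second_line (D.swap₂₃ (D.swap₁₂ (D.swap₃₄ p2)))
  have m1 : ∀ b, b ∈ [o, a, a', a'', c, d, u, v, i, j] := fun b =>
    D.cover_of_line h h1 h2 hN hE hN'' c1 c2 u1 u2 i1 i2
  have m2 : ∀ b, b ∈ [o, a, a'', a', c, d, u', v', e, f] := fun b =>
    D.cover_of_line (D.swap₃₄ h) h2 h1 hN hE' hN' c3 c4 u1' u2' e1 e2
  have m3 : ∀ b, b ∈ [o, a', a, a'', e, f, x, y, i, j] := fun b =>
    D.cover_of_line p2 (D.R_symm h1) (D.R_trans (D.R_symm h1) h2) hN' hF hN'' e1 e2 x1 x2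
      i3 i4
  have d2 := nodup_of_card (by simpa using hn) m2
  have d3 := nodup_of_card (by simpa using hn) m3
  have me := m1 e
  have mf := m1 f
  simp only [List.nodup_cons, List.mem_cons, List.not_mem_nil, or_false, not_or] at d2 d3 me mf
  have he : e = u ∨ e = v := by grind
  have hf : f = u ∨ f = v := by grind
  have ef := (D.Q_ne_all hN').2.2.2.2.2
  have hQ : D.Q a a'' e f := by
    have hE'' := D.swap₃₄ hE
    rcases he with rfl | rfl <;> rcases hf with rfl | rfl
    · exact absurd rfl ef
    · exact hE
    · exact hE''
    · exact absurd rfl ef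
  have eo : e ≠ o := (D.Q_ne_all hN').2.1.symm
  have ea : a ≠ e := e1
  have ne : ∀ w, ¬ D.Q o a e w := fun w hw => by
    have := D.mem_of_two_lines h hN c1 c2 hw
    grind
  have key := D.R_loop_of_not_collinear eo ea ne h1
  have k1 : D.M o a a' = a'' := D.M_line h
  have k2 : D.M a e a'' = f := D.M_line (D.swap₂₃ hQ)
  have k3 : D.M e o f = a' :=
    D.M_line (D.swap₃₄ (D.swap₁₂ (D.swap₂₃ hN')))
  simp only [loop, k1, k2, k3] at key
  have := D.block_eq h1 h2 h0.2.2.2.1 h0.2.2.2.2.1 h0.2.2.2.2.2 (D.R_trans h1 (D.R_symm key))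
  grind

/-- With more than seven points, points of a common triple are not collinear with the hole. -/
lemma not_collinear_of_R [Fintype α] (hn : 10 ≤ Fintype.card α) {a b p : α}
    (hR : D.R a b) : ¬ D.Q o a b p := by
  intro h
  have h0 := D.Q_ne_all h
  obtain ⟨y, z, n1, n2, n3, R1, R2, hall⟩ := D.block (D.R_ne hR)
  obtain ⟨c, hc, ac, bc⟩ : ∃ c, D.R a c ∧ a ≠ c ∧ b ≠ c := by
    rcases hall b hR with e | e | e
    · exact absurd e.symm h0.2.2.2.1
    · exact ⟨z, R2, n2, e ▸ n3⟩
    · exact ⟨y, R1, n1, e ▸ n3.symm⟩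
  obtain rfl := D.third_mem_line hn h hR hc ac bc
  exact D.not_line_block hn h hR hc

lemma false_of_thirteen_le [Fintype α] (hn : 13 ≤ Fintype.card α) {a : α} (ha : a ≠ o) :
    False := by
  obtain ⟨a', a'', n1, n2, n3, h1, h2, hall⟩ := D.block ha
  have hN : ∀ {y z p}, D.R y z → ¬ D.Q o y z p := D.not_collinear_of_R (by omega)
  have ho := D.R_ne (D.R_symm h1)
  obtain ⟨x₁, y₁, x₂, y₂, -, -, -, -, -, -, hx⟩ := D.lines ha.symm
  obtain ⟨u₁, v₁, u₂, v₂, -, -, -, -, -, -, hu⟩ := D.lines n1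
  obtain ⟨b, hb⟩ := exists_notMem_of_card
    [o, a, a', a'', x₁, y₁, x₂, y₂, u₁, v₁, u₂, v₂] (by simp; omega)
  simp only [List.mem_cons, List.not_mem_nil, or_false, not_or] at hb
  obtain ⟨b1, b2, b3, b4, hb⟩ := hb
  have nb : ∀ w, ¬ D.Q o a b w := fun w hw => by
    have := hx _ _ hw
    grind
  have nR : ¬ D.R a b := fun h => by
    have := hall b h
    grind
  have key := D.R_loop_of_not_collinear b1 (Ne.symm b2) nb h1
  have e1 : D.M o a a' = a' := D.M_fix ha.symm ho n1.symm fun w => hN h1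
  have e2 : D.M a b a' = a' := D.M_fix (Ne.symm b2) n1.symm (Ne.symm b3) fun w hw => by
    have := hu _ _ (D.swap₂₃ hw)
    grind
  simp only [loop, e1, e2] at key
  rcases D.M_cases b1 (Ne.symm b3) ho with hz | ⟨_, e3⟩
  · exact hN key (D.swap₁₂ (D.swap₃₄ hz))
  · rw [e3] at key
    exact nR (D.R_trans h1 (D.R_symm key))

omit D in
lemma mem_of_nodup_of_card [Fintype α] {l : List α} (hl : l.Nodup)
    (h : l.length = Fintype.card α) (b : α) : b ∈ l := by
  classical
  have : l.toFinset = Finset.univ :=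
    Finset.eq_univ_of_card _ ((List.toFinset_card_of_nodup hl).trans h)
  have hb := Finset.mem_univ b
  rwa [← this, List.mem_toFinset] at hb

lemma ne_of_not_R {a b x y : α} (hR : ¬ D.R a b) (hx : D.R a x) (hy : D.R b y) : x ≠ y := by
  rintro rfl
  exact hR (D.R_trans hx (D.R_symm hy))

lemma R_or_of_ten [Fintype α] (hn : Fintype.card α = 10) {a b c z : α} (ha : a ≠ o)
    (hb : b ≠ o) (hc : c ≠ o) (hab : ¬ D.R a b) (hac : ¬ D.R a c) (hbc : ¬ D.R b c)
    (hz : z ≠ o) : D.R a z ∨ D.R b z ∨ D.R c z := by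
  obtain ⟨a₁, a₂, a3, a4, a5, a6, a7, -⟩ := D.block ha
  obtain ⟨b₁, b₂, b3, b4, b5, b6, b7, -⟩ := D.block hb
  obtain ⟨c₁, c₂, c3, c4, c5, c6, c7, -⟩ := D.block hc
  have Ra := D.R_refl ha
  have Rb := D.R_refl hb
  have Rc := D.R_refl hc
  have dab := fun x y => D.ne_of_not_R (x := x) (y := y) hab
  have dac := fun x y => D.ne_of_not_R (x := x) (y := y) hac
  have dbc := fun x y => D.ne_of_not_R (x := x) (y := y) hbc
  have hR := @D.R_ne
  have hR' : ∀ {x y}, D.R x y → y ≠ o := fun h => D.R_ne (D.R_symm h)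
  have hm := mem_of_nodup_of_card (l := [o, a, a₁, a₂, b, b₁, b₂, c, c₁, c₂])
    (by simp only [List.nodup_cons, List.mem_cons, List.not_mem_nil, or_false, not_or]; grind)
    (by simp [hn]) z
  simp only [List.mem_cons, List.not_mem_nil, or_false] at hm
  grind

/-- With ten points, the second line through the hole and a point meets each of the two other
triples. -/
lemma exists_line_of_ten [Fintype α] (hn : Fintype.card α = 10) {a b c : α} (h : D.Q o a b c) :
    ∃ x y, D.Q o a x y ∧ D.R b x ∧ D.R c y ∧ b ≠ x ∧ c ≠ y := by
  have hN : ∀ {y z p}, D.Q o y z p → ¬ D.R y z := fun h hR =>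
    D.not_collinear_of_R hn.ge hR h
  have h0 := D.Q_ne_all h
  obtain ⟨x, y, hxy, n1, n2, n3, n4, -⟩ := D.exists_second_line h
  have k0 := D.Q_ne_all hxy
  have ax := hN hxy
  have ay := hN (D.swap₃₄ hxy)
  have xy := hN (D.swap₃₄ (D.swap₂₃ hxy))
  have cov : ∀ z, z ≠ o → D.R a z ∨ D.R b z ∨ D.R c z := fun z =>
    D.R_or_of_ten hn h0.1.symm h0.2.1.symm h0.2.2.1.symm (hN h) (hN (D.swap₃₄ h))
      (hN (D.swap₃₄ (D.swap₂₃ h)))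
  have tr : ∀ z, D.R z x → ¬ D.R z y := fun z h1 h2 => xy (D.R_trans (D.R_symm h1) h2)
  rcases cov x k0.2.1.symm with hx | hx | hx
  · exact absurd hx ax
  · rcases cov y k0.2.2.1.symm with hy | hy | hy
    · exact absurd hy ay
    · exact absurd hy (tr b hx)
    · exact ⟨x, y, hxy, hx, hy, n1, n4⟩
  · rcases cov y k0.2.2.1.symm with hy | hy | hy
    · exact absurd hy ay
    · exact ⟨y, x, D.swap₃₄ hxy, hy, hx, n2, n3⟩
    · exact absurd hy (tr c hx)

lemma false_of_ten [Fintype α] (hn : Fintype.card α = 10) {a : α} (ha : a ≠ o) : False := by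
  have hN : ∀ {y z p}, D.Q o y z p → ¬ D.R y z := fun h hR =>
    D.not_collinear_of_R hn.ge hR h
  obtain ⟨b, c, -, -, h, -⟩ := D.lines ha.symm
  have h0 := D.Q_ne_all h
  have nab := hN h
  have nac := hN (D.swap₃₄ h)
  have nbc := hN (D.swap₃₄ (D.swap₂₃ h))
  obtain ⟨x, y, hxy, bx, cy, -, hcy⟩ := D.exists_line_of_ten hn h
  obtain ⟨w, z, hwz, aw, cz, haw, -⟩ := D.exists_line_of_ten hn (D.swap₂₃ h)
  have k0 := D.Q_ne_all hxy
  have l0 := D.Q_ne_all hwz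
  have Rb := D.R_refl h0.2.1.symm
  have yb : y ≠ b := (D.ne_of_not_R nbc Rb cy).symm
  have key := D.R_loop h0.1.symm h0.2.1.symm h0.2.2.2.1 bx
  rw [D.loop_right h, loop, D.M_line hxy] at key
  obtain ⟨t, ht, bt⟩ : ∃ t, D.Q a b y t ∧ D.R b t := by
    rcases D.M_cases h0.2.2.2.1 k0.2.2.2.2.1.symm yb with hq | ⟨_, e⟩
    · refine ⟨_, hq, ?_⟩
      set t := D.M a b y
      have t0 := D.Q_ne_all hq
      have hto : t ≠ o := by
        intro e
        rw [e] at hq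
        exact hcy (D.unique h (D.swap₁₂ (D.swap₂₃ (D.swap₃₄ hq))))
      rcases D.M_cases h0.2.1.symm t0.2.2.2.2.1.symm hto with hs | ⟨_, e⟩
      · exact absurd key (hN (D.swap₁₂ (D.swap₃₄ hs)))
      · rwa [e] at key
    · rw [e] at key
      rcases D.M_cases h0.2.1.symm yb k0.2.2.1.symm with hs | ⟨_, e⟩
      · exact absurd key (hN (D.swap₁₂ (D.swap₃₄ hs)))
      · rw [e] at key
        exact absurd rfl (D.ne_of_not_R nbc key cy)
  have g1 : D.M o a w = w :=
    D.M_fix h0.1 l0.2.1.symm haw.symm fun s hs => hN hs aw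
  have g2 : D.M a b w = w := by
    refine D.M_fix h0.2.2.2.1 haw.symm l0.2.2.2.1.symm fun s hs => ?_
    have := D.mem_of_two_lines (D.swap₂₃ (D.swap₁₂ h)) ht k0.2.2.1
      (D.R_ne (D.R_symm bt)).symm hs
    have d1 := D.ne_of_not_R nac aw cy
    have d2 := D.ne_of_not_R nac aw (D.R_refl h0.2.2.1.symm)
    have d3 := D.ne_of_not_R nab aw bt
    have := l0.2.1
    grind
  have g3 : D.M b o w = z := D.M_line (D.swap₁₂ hwz)
  have key' := D.R_loop h0.1.symm h0.2.1.symm h0.2.2.2.1 aw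
  rw [D.loop_left h, loop, g1, g2, g3] at key'
  exact D.ne_of_not_R nac key' cz rfl

/-- With seven points, the lines through two points miss exactly one point. -/
lemma exists_line_of_seven [Fintype α] (hn : Fintype.card α = 7) {x y t z : α} (hxy : x ≠ y)
    (hx : t ≠ x) (hy : t ≠ y) (ht : ∀ w, ¬ D.Q x y t w) (h1 : z ≠ x) (h2 : z ≠ y)
    (h3 : z ≠ t) : ∃ w, D.Q x y z w := by
  obtain ⟨x₁, y₁, x₂, y₂, l1, l2, n1, n2, n3, n4, -⟩ := D.lines hxy
  have k1 := D.Q_ne_all l1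
  have k2 := D.Q_ne_all l2
  have l3 := D.swap₃₄ l1
  have l4 := D.swap₃₄ l2
  have hm := mem_of_nodup_of_card (l := [x, y, t, x₁, y₁, x₂, y₂])
    (by simp only [List.nodup_cons, List.mem_cons, List.not_mem_nil, or_false, not_or]; grind)
    (by simp [hn]) z
  simp only [List.mem_cons, List.not_mem_nil, or_false] at hm
  grind

lemma false_of_seven_of_not_collinear [Fintype α] (hn : Fintype.card α = 7) {a b : α}
    (ha : a ≠ o) (hb : b ≠ o) (hab : ¬ D.R a b) (h : ∀ w, ¬ D.Q o a b w) : False := by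
  have ne : a ≠ b := by rintro rfl; exact hab (D.R_refl ha)
  obtain ⟨a', -, n1, -, -, h1, -⟩ := D.block ha
  have n2 : a' ≠ b := by rintro rfl; exact hab h1
  have ho := D.R_ne (D.R_symm h1)
  have La : ∀ z, z ≠ o → z ≠ a → z ≠ b → ∃ w, D.Q o a z w := fun z =>
    D.exists_line_of_seven hn ha.symm hb ne.symm h
  have Lab : ∀ z, z ≠ a → z ≠ b → z ≠ o → ∃ w, D.Q a b z w := fun z =>
    D.exists_line_of_seven hn ne ha.symm hb.symm fun w hw => h w (D.swap₁₂ (D.swap₂₃ hw))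
  have Lb : ∀ z, z ≠ b → z ≠ o → z ≠ a → ∃ w, D.Q b o z w := fun z =>
    D.exists_line_of_seven hn hb ne ha fun w hw => h w (D.swap₂₃ (D.swap₁₂ hw))
  obtain ⟨y, hy⟩ := La a' ho n1.symm n2
  have y0 := D.Q_ne_all hy
  have yb : y ≠ b := by rintro rfl; exact h _ (D.swap₃₄ hy)
  obtain ⟨z, hz⟩ := Lab y y0.2.2.2.2.1.symm yb y0.2.2.1.symm
  have z0 := D.Q_ne_all hz
  have zo : z ≠ o := by
    rintro rfl
    exact h _ (D.swap₁₂ (D.swap₂₃ (D.swap₃₄ hz)))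
  obtain ⟨s, hs⟩ := Lb z z0.2.2.2.2.1.symm zo z0.2.2.1.symm
  have s0 := D.Q_ne_all hs
  obtain ⟨w, hw⟩ := La z zo z0.2.2.1.symm z0.2.2.2.2.1.symm
  have w0 := D.Q_ne_all hw
  have wb : w ≠ b := by rintro rfl; exact h _ (D.swap₃₄ hw)
  have za' : z ≠ a' := by
    rintro rfl
    exact hb (D.unique (D.swap₂₃ (D.swap₃₄ (D.swap₂₃ hz)))
      (D.swap₃₄ (D.swap₂₃ (D.swap₁₂ hy))))
  have wy : w ≠ y := by
    rintro rfl
    exact za' (D.unique (D.swap₃₄ hw) (D.swap₃₄ hy))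
  have wa' : w ≠ a' := by
    rintro rfl
    exact z0.2.2.2.2.2 (D.unique hy (D.swap₃₄ hw))
  have sa : s ≠ a := by
    rintro rfl
    exact h z (D.swap₂₃ (D.swap₁₂ (D.swap₃₄ hs)))
  have sy : s ≠ y := by
    rintro rfl
    exact ha (D.unique (D.swap₃₄ (D.swap₂₃ (D.swap₁₂ (D.swap₃₄ hz))))
      (D.swap₃₄ (D.swap₂₃ hs)))
  have sw : s ≠ w := by
    rintro rfl
    exact ne (D.unique (D.swap₃₄ (D.swap₂₃ hw)) (D.swap₃₄ (D.swap₂₃ (D.swap₁₂ hs))))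
  have hm := mem_of_nodup_of_card (l := [o, a, b, a', y, z, w])
    (by simp only [List.nodup_cons, List.mem_cons, List.not_mem_nil, or_false, not_or]; grind)
    (by simp [hn]) s
  simp only [List.mem_cons, List.not_mem_nil, or_false] at hm
  obtain rfl : s = a' := by grind
  have key := D.R_loop_of_not_collinear hb ne h h1
  rw [loop, D.M_line hy, D.M_line hz, D.M_line hs] at key
  exact hab (D.R_trans h1 (D.R_symm key))

lemma false_of_seven [Fintype α] (hn : Fintype.card α = 7) {a : α} (ha : a ≠ o) : False := by
  have col : ∀ {a b}, a ≠ o → b ≠ o → ¬ D.R a b → ∃ w, D.Q o a b w := by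
    intro a b h1 h2 h3
    by_contra! h
    exact D.false_of_seven_of_not_collinear hn h1 h2 h3 h
  obtain ⟨a', a'', n1, n2, n3, h1, h2, hall⟩ := D.block ha
  obtain ⟨s, hs⟩ := exists_notMem_of_card [o, a, a', a''] (by simp; omega)
  simp only [List.mem_cons, List.not_mem_nil, or_false, not_or] at hs
  have hR : ¬ D.R a s := fun h => by
    have := hall s h
    grind
  obtain ⟨s', s'', m1, m2, m3, k1, k2, -⟩ := D.block hs.1
  have cov : ∀ b, b = o ∨ b = a ∨ b = a' ∨ b = a'' ∨ b = s ∨ b = s' ∨ b = s'' := by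
    intro b
    have dab := fun x y => D.ne_of_not_R (x := x) (y := y) hR
    have Ra := D.R_refl ha
    have Rb := D.R_refl hs.1
    have hR' : ∀ {x y}, D.R x y → y ≠ o := fun h => D.R_ne (D.R_symm h)
    have hm := mem_of_nodup_of_card (l := [o, a, a', a'', s, s', s''])
      (by simp only [List.nodup_cons, List.mem_cons, List.not_mem_nil, or_false, not_or]; grind)
      (by simp [hn]) b
    simpa using hm
  have one : ∀ {p q r}, D.R a p → q ≠ p → r ≠ p → q ≠ r → D.R a q → D.R a r →
      ((∃ w, D.Q o p q w) ↔ ¬ ∃ w, D.Q o p r w) := by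
    intro p q r hp n1 n2 n3 hq hr
    have po := D.R_ne (D.R_symm hp)
    have out : ∀ {t}, D.R s t → ∃ w, D.Q o p t w := fun ht =>
      col po (D.R_ne (D.R_symm ht)) fun h => hR (D.R_trans (D.R_trans hp h) (D.R_symm ht))
    have e1 := hall _ hp
    have e2 := hall _ hq
    have e3 := hall _ hr
    have o1 := out (D.R_refl hs.1)
    have o2 := out k1
    have o3 := out k2
    have dq := fun t => D.ne_of_not_R hR hq (y := t)
    have dr := fun t => D.ne_of_not_R hR hr (y := t)
    have q1 := dq _ (D.R_refl hs.1)
    have q2 := dq _ k1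
    have q3 := dq _ k2
    have r1 := dr _ (D.R_refl hs.1)
    have r2 := dr _ k1
    have r3 := dr _ k2
    obtain ⟨x₁, y₁, x₂, y₂, l1, l2, d1, d2, d3, d4, hx⟩ := D.lines po.symm
    have c1 := D.Q_ne_all l1
    have c2 := D.Q_ne_all l2
    have l3 := D.swap₃₄ l1
    have l4 := D.swap₃₄ l2
    have i1 : ∀ t, (∃ w, D.Q o p t w) ↔ t = x₁ ∨ t = y₁ ∨ t = x₂ ∨ t = y₂ := by
      refine fun t => ⟨fun ⟨w, hw⟩ => hx t w hw, ?_⟩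
      rintro (rfl | rfl | rfl | rfl)
      exacts [⟨_, l1⟩, ⟨_, l3⟩, ⟨_, l2⟩, ⟨_, l4⟩]
    rw [i1] at o1 o2 o3
    rw [i1, i1]
    refine ⟨fun hq' hr' => ?_, fun hr' => ?_⟩
    · have nd : [q, r, s, s', s''].Nodup := by
        simp only [List.nodup_cons, List.mem_cons, List.not_mem_nil, or_false, not_or]
        simp_all
      have sub : [q, r, s, s', s''] ⊆ [x₁, y₁, x₂, y₂] := by
        simp only [List.cons_subset, List.mem_cons, List.not_mem_nil, or_false]
        exact ⟨hq', hr', o1, o2, o3, List.nil_subset _⟩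
      simpa using (nd.subperm sub).length_le
    · by_contra hq'
      have nd : [o, p, q, r, x₁, y₁, x₂, y₂].Nodup := by
        have := D.R_ne (D.R_symm hq)
        have := D.R_ne (D.R_symm hr)
        clear hx i1 cov out dq dr hall col
        simp only [List.nodup_cons, List.mem_cons, List.not_mem_nil, or_false, not_or] at hq' hr' ⊢
        grind
      simpa [hn] using nd.length_le_card
  have Ra := D.R_refl ha
  have sym : ∀ {p q}, (∃ w, D.Q o p q w) ↔ ∃ w, D.Q o q p w :=
    ⟨fun ⟨w, hw⟩ => ⟨w, D.swap₂₃ hw⟩, fun ⟨w, hw⟩ => ⟨w, D.swap₂₃ hw⟩⟩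
  have t1 := one Ra n1.symm n2.symm n3 h1 h2
  have t2 := one h1 n1 n3.symm n2 Ra h2
  have t3 := one h2 n2 n3 n1 Ra h1
  rw [sym (p := a')] at t2
  rw [sym (p := a''), sym (p := a'') (q := a')] at t3
  generalize (∃ w, D.Q o a a' w) = x at t1 t2
  generalize (∃ w, D.Q o a a'' w) = y at t1 t3
  clear one sym cov col
  tauto

end TripleBlockData

/-- The points `x, y, z, w` are distinct and form a line. -/
def HGQuad (B : Finset (Finset Ω)) (x y z w : Ω) : Prop :=
  x ≠ y ∧ x ≠ z ∧ x ≠ w ∧ y ≠ z ∧ y ≠ w ∧ z ≠ w ∧ ({x, y, z, w} : Finset Ω) ∈ B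

omit [Fintype Ω] in
lemma HGQuad.swap₁₂ {B : Finset (Finset Ω)} {x y z w : Ω} (h : HGQuad B x y z w) :
    HGQuad B y x z w := by
  obtain ⟨h1, h2, h3, h4, h5, h6, h7⟩ := h
  refine ⟨h1.symm, h4, h5, h2, h3, h6, ?_⟩
  rwa [Finset.insert_comm]

omit [Fintype Ω] in
lemma HGQuad.swap₂₃ {B : Finset (Finset Ω)} {x y z w : Ω} (h : HGQuad B x y z w) :
    HGQuad B x z y w := by
  obtain ⟨h1, h2, h3, h4, h5, h6, h7⟩ := h
  refine ⟨h2, h1, h3, h4.symm, h6, h5, ?_⟩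
  rwa [Finset.insert_comm z]

omit [Fintype Ω] in
lemma HGQuad.swap₃₄ {B : Finset (Finset Ω)} {x y z w : Ω} (h : HGQuad B x y z w) :
    HGQuad B x y w z := by
  obtain ⟨h1, h2, h3, h4, h5, h6, h7⟩ := h
  refine ⟨h1, h3, h2, h5, h4, h6.symm, ?_⟩
  rwa [Finset.pair_comm w]

omit [Fintype Ω] in
lemma HGSupersimple.eq_of_mem {B : Finset (Finset Ω)} (hss : HGSupersimple B)
    {b c : Finset Ω} (hb : b ∈ B) (hc : c ∈ B) {x y z : Ω} (hxy : x ≠ y) (hxz : x ≠ z)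
    (hyz : y ≠ z) (h1 : x ∈ b ∧ y ∈ b ∧ z ∈ b) (h2 : x ∈ c ∧ y ∈ c ∧ z ∈ c) : b = c := by
  by_contra hbc
  have h3 : ({x, y, z} : Finset Ω) ⊆ b ∩ c := by
    intro t ht
    simp only [Finset.mem_insert, Finset.mem_singleton] at ht
    rcases ht with rfl | rfl | rfl <;> simp_all
  have h4 := Finset.card_le_card h3
  rw [Finset.card_eq_three.2 ⟨x, y, z, hxy, hxz, hyz, rfl⟩] at h4
  have := hss b hb c hc hbc
  omega

omit [Fintype Ω] in
lemma exists_pair_of_line {b : Finset Ω} (hb : b.card = 4) {x y : Ω} (hxy : x ≠ y)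
    (hx : x ∈ b) (hy : y ∈ b) :
    ∃ z w, x ≠ z ∧ x ≠ w ∧ y ≠ z ∧ y ≠ w ∧ z ≠ w ∧ b = {x, y, z, w} := by
  have h1 : ((b.erase x).erase y).card = 2 := by
    rw [Finset.card_erase_of_mem (by simp [hy, hxy.symm]), Finset.card_erase_of_mem hx, hb]
  obtain ⟨z, w, hzw, h2⟩ := Finset.card_eq_two.1 h1
  have hz : z ∈ (b.erase x).erase y := by simp [h2]
  have hw : w ∈ (b.erase x).erase y := by simp [h2]
  simp only [Finset.mem_erase] at hz hw
  refine ⟨z, w, hz.2.1.symm, hw.2.1.symm, hz.1.symm, hw.1.symm, hzw, ?_⟩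
  rw [← h2, Finset.insert_erase (by simp [hy, hxy.symm]), Finset.insert_erase hx]

omit [Fintype Ω] in
lemma HGSupersimple.quad_unique {B : Finset (Finset Ω)} (hss : HGSupersimple B)
    {x y z w w' : Ω} (h : HGQuad B x y z w) (h' : HGQuad B x y z w') : w = w' := by
  obtain ⟨h1, h2, h3, h4, h5, h6, h7⟩ := h
  obtain ⟨-, -, k3, -, k5, k6, k7⟩ := h'
  have e := hss.eq_of_mem h7 k7 h1 h2 h4 (by simp) (by simp)
  have : w ∈ ({x, y, z, w'} : Finset Ω) := e ▸ by simp
  simp only [Finset.mem_insert, Finset.mem_singleton] at this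
  grind

omit [Fintype Ω] in
lemma exists_quads {B : Finset (Finset Ω)} (hdes : IsTwoDesign B 2) (hss : HGSupersimple B)
    {x y : Ω} (hxy : x ≠ y) :
    ∃ x₁ y₁ x₂ y₂, HGQuad B x y x₁ y₁ ∧ HGQuad B x y x₂ y₂ ∧
      x₁ ≠ x₂ ∧ x₁ ≠ y₂ ∧ y₁ ≠ x₂ ∧ y₁ ≠ y₂ ∧
      ∀ z w, HGQuad B x y z w → z = x₁ ∨ z = y₁ ∨ z = x₂ ∨ z = y₂ := by
  obtain ⟨b, c, hbc, hf⟩ := Finset.card_eq_two.1 (hdes.2 x y hxy)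
  have hb : b ∈ B ∧ x ∈ b ∧ y ∈ b := by
    have : b ∈ B.filter fun b => x ∈ b ∧ y ∈ b := by simp [hf]
    simpa using this
  have hc : c ∈ B ∧ x ∈ c ∧ y ∈ c := by
    have : c ∈ B.filter fun b => x ∈ b ∧ y ∈ b := by simp [hf]
    simpa using this
  obtain ⟨x₁, y₁, n1, n2, n3, n4, n5, rfl⟩ :=
    exists_pair_of_line (hdes.1 b hb.1) hxy hb.2.1 hb.2.2
  obtain ⟨x₂, y₂, m1, m2, m3, m4, m5, rfl⟩ :=
    exists_pair_of_line (hdes.1 c hc.1) hxy hc.2.1 hc.2.2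
  have key : ∀ z, x ≠ z → y ≠ z → z ∈ ({x, y, x₁, y₁} : Finset Ω) →
      z ∉ ({x, y, x₂, y₂} : Finset Ω) := fun z h1 h2 h3 h4 =>
    hbc (hss.eq_of_mem hb.1 hc.1 hxy h1 h2 ⟨by simp, by simp, h3⟩ ⟨by simp, by simp, h4⟩)
  have k1 := key x₁ n1 n3 (by simp)
  have k2 := key y₁ n2 n4 (by simp)
  simp only [Finset.mem_insert, Finset.mem_singleton, not_or] at k1 k2
  refine ⟨x₁, y₁, x₂, y₂, ⟨hxy, n1, n2, n3, n4, n5, hb.1⟩, ⟨hxy, m1, m2, m3, m4, m5, hc.1⟩,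
    k1.2.2.1, k1.2.2.2, k2.2.2.1, k2.2.2.2, ?_⟩
  rintro z w ⟨-, q2, -, q4, -, -, q7⟩
  have hm : ({x, y, z, w} : Finset Ω) ∈ B.filter fun b => x ∈ b ∧ y ∈ b := by simp [q7]
  rw [hf, Finset.mem_insert, Finset.mem_singleton] at hm
  rcases hm with e | e
  · have : z ∈ ({x, y, x₁, y₁} : Finset Ω) := e ▸ by simp
    simp only [Finset.mem_insert, Finset.mem_singleton] at this
    grind
  · have : z ∈ ({x, y, x₂, y₂} : Finset Ω) := e ▸ by simp
    simp only [Finset.mem_insert, Finset.mem_singleton] at this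
    grind

omit [Fintype Ω] in
lemma exists_isElemMove_s17 {B : Finset (Finset Ω)} (hdes : IsTwoDesign B 2)
    (hss : HGSupersimple B) {x y : Ω} (hxy : x ≠ y) :
    ∃ e : Equiv.Perm Ω, IsElemMove B x y e := by
  obtain ⟨x₁, y₁, x₂, y₂, h1, h2, n1, n2, n3, n4, hall⟩ := exists_quads hdes hss hxy
  have quad : ∀ b ∈ B, x ∈ b → y ∈ b → ∀ z ∈ b, z ≠ x → z ≠ y → ∀ w ∈ b, w ≠ x → w ≠ y →
      w ≠ z → HGQuad B x y z w := by
    intro b hb hx hy z hz zx zy w hw wx wy wz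
    refine ⟨hxy, zx.symm, wx.symm, zy.symm, wy.symm, wz.symm, ?_⟩
    suffices ({x, y, z, w} : Finset Ω) = b by rwa [this]
    apply Finset.eq_of_subset_of_card_le
    · intro t ht
      simp only [Finset.mem_insert, Finset.mem_singleton] at ht
      rcases ht with rfl | rfl | rfl | rfl <;> assumption
    · rw [hdes.1 b hb, Finset.card_insert_of_notMem (by simp; grind),
        Finset.card_eq_three.2 ⟨y, z, w, zy.symm, wy.symm, wz.symm, rfl⟩]
  have u := @HGSupersimple.quad_unique _ _ _ hss x y
  have l1 := h1.swap₃₄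
  have l2 := h2.swap₃₄
  have e1 := h1
  have e2 := h2
  obtain ⟨-, a1, a2, a3, a4, a5, hb⟩ := h1
  obtain ⟨-, b1, b2, b3, b4, b5, hc⟩ := h2
  refine ⟨Equiv.swap x y * Equiv.swap x₁ y₁ * Equiv.swap x₂ y₂, Or.inr
    ⟨hxy, ⟨_, hb, by simp, by simp⟩, ?_, ?_, fun z zx zy => ⟨fun hz => ?_, ?_⟩⟩⟩
  · simp only [Equiv.Perm.mul_apply, Equiv.swap_apply_def]; grind
  · simp only [Equiv.Perm.mul_apply, Equiv.swap_apply_def]; grind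
  · have c1 := hz _ hb
    have c2 := hz _ hc
    simp only [Finset.mem_insert, Finset.mem_singleton] at c1 c2
    simp only [Equiv.Perm.mul_apply, Equiv.swap_apply_def]; grind
  · intro b hb hx hy hz w hw wx wy wz
    have hq := quad b hb hx hy z hz zx zy w hw wx wy wz
    have := hall z w hq
    simp only [Equiv.Perm.mul_apply, Equiv.swap_apply_def]; grind

omit [DecidableEq Ω] [Fintype Ω] in
lemma holeStab_loop {B : Finset (Finset Ω)} {x a b : Ω} {e f g : Equiv.Perm Ω}
    (he : IsElemMove B x a e) (hf : IsElemMove B a b f) (hg : IsElemMove B b x g) :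
    g * f * e ∈ holeStab B x :=
  ⟨[x, a, b, x], rfl, rfl, e, g * f, he, ⟨f, g, hf, ⟨g, 1, hg, rfl, by simp⟩, rfl⟩, rfl⟩

/-- The combinatorial data of a supersimple `2-(n,4,2)` design whose hole stabilizer preserves
a system of imprimitivity with blocks of size three. -/
noncomputable def tripleBlockData {B : Finset (Finset Ω)} (hdes : IsTwoDesign B 2)
    (hss : HGSupersimple B) {x : Ω} {P : Finset (Finset Ω)} {l : ℕ}
    (hP : IsHoleBlockSystem B x P 3 l) : TripleBlockData Ω x := by
  have hm : ∀ x y : Ω, ∃ e : Equiv.Perm Ω, x ≠ y → IsElemMove B x y e := by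
    intro x y
    by_cases hxy : x = y
    · exact ⟨1, fun h => absurd hxy h⟩
    · obtain ⟨e, he⟩ := exists_isElemMove_s17 hdes hss hxy
      exact ⟨e, fun _ => he⟩
  choose m hm using hm
  have hm' := fun x y (h : x ≠ y) => (hm x y h).resolve_left fun h' => h h'.1
  obtain ⟨-, -, -, hcard, hcov, hx, hinv⟩ := hP
  exact
  { Q := HGQuad B
    M := fun x y z => m x y z
    R := fun y z => ∃ Δ ∈ P, y ∈ Δ ∧ z ∈ Δ
    swap₁₂ := HGQuad.swap₁₂
    swap₂₃ := HGQuad.swap₂₃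
    swap₃₄ := HGQuad.swap₃₄
    ne := fun h => h.1
    unique := hss.quad_unique
    lines := exists_quads hdes hss
    M_left := fun h => (hm' _ _ h).2.2.1
    M_right := fun h => (hm' _ _ h).2.2.2.1
    M_line := by
      rintro x y z w ⟨h1, h2, h3, h4, h5, h6, h7⟩
      exact ((hm' x y h1).2.2.2.2 z h2.symm h4.symm).2 _ h7 (by simp) (by simp) (by simp) w
        (by simp) h3.symm h5.symm h6.symm
    M_fix := by
      intro x y z hxy zx zy h
      refine ((hm' x y hxy).2.2.2.2 z zx zy).1 fun b hb hmem => ?_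
      obtain ⟨u, w, n1, n2, n3, n4, n5, rfl⟩ :=
        exists_pair_of_line (hdes.1 b hb) hxy hmem.1 hmem.2.1
      have hz := hmem.2.2
      have hq : HGQuad B x y u w := ⟨hxy, n1, n2, n3, n4, n5, hb⟩
      simp only [Finset.mem_insert, Finset.mem_singleton, zx, zy, false_or] at hz
      rcases hz with rfl | rfl
      exacts [h _ hq, h _ hq.swap₃₄]
    M_injective := fun _ => (m _ _).injective
    R_refl := fun h => by
      obtain ⟨Δ, ⟨h1, h2⟩, -⟩ := hcov _ h
      exact ⟨Δ, h1, h2, h2⟩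
    R_symm := fun ⟨Δ, h1, h2, h3⟩ => ⟨Δ, h1, h3, h2⟩
    R_trans := by
      rintro y z w ⟨Δ, h1, h2, h3⟩ ⟨Δ', k1, k2, k3⟩
      have hz : z ≠ x := by rintro rfl; exact hx Δ h1 h3
      obtain rfl := (hcov z hz).unique ⟨h1, h3⟩ ⟨k1, k2⟩
      exact ⟨Δ, h1, h2, k3⟩
    R_ne := by
      rintro y z ⟨Δ, h1, h2, h3⟩ rfl
      exact hx Δ h1 h2
    block := by
      intro y hy
      obtain ⟨Δ, ⟨h1, h2⟩, h3⟩ := hcov y hy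
      have h4 : (Δ.erase y).card = 2 := by rw [Finset.card_erase_of_mem h2, hcard Δ h1]
      obtain ⟨z, w, hzw, h5⟩ := Finset.card_eq_two.1 h4
      have hz : z ∈ Δ.erase y := by simp [h5]
      have hw : w ∈ Δ.erase y := by simp [h5]
      rw [Finset.mem_erase] at hz hw
      refine ⟨z, w, hz.1.symm, hw.1.symm, hzw, ⟨Δ, h1, h2, hz.2⟩, ⟨Δ, h1, h2, hw.2⟩, ?_⟩
      rintro t ⟨Δ', k1, k2, k3⟩
      obtain rfl := h3 Δ' ⟨k1, k2⟩
      rw [← Finset.insert_erase h2, h5] at k3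
      simpa using k3
    R_move := by
      rintro a b ha hb hab y z ⟨Δ, h1, h2, h3⟩
      have hg := hinv _ (holeStab_loop (hm x a ha.symm) (hm a b hab) (hm b x hb)) Δ h1
      exact ⟨_, hg, Finset.mem_image_of_mem _ h2, Finset.mem_image_of_mem _ h3⟩ }

lemma IsHoleBlockSystem.card {B : Finset (Finset Ω)} {x : Ω} {P : Finset (Finset Ω)} {k l : ℕ}
    (hP : IsHoleBlockSystem B x P k l) : Fintype.card Ω = l * k + 1 := by
  obtain ⟨hl, -, -, hcard, hcov, hx, -⟩ := hP
  have h1 : P.biUnion id = Finset.univ.erase x := by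
    ext a
    simp only [Finset.mem_biUnion, id, Finset.mem_erase, Finset.mem_univ, and_true]
    constructor
    · rintro ⟨Δ, h1, h2⟩ rfl
      exact hx Δ h1 h2
    · intro ha
      obtain ⟨Δ, h, -⟩ := hcov a ha
      exact ⟨Δ, h⟩
  have h2 : (P.biUnion id).card = ∑ Δ ∈ P, Δ.card := by
    refine Finset.card_biUnion fun Δ h Δ' h' hne => Finset.disjoint_left.2 fun a ha ha' => hne ?_
    have hax : a ≠ x := by rintro rfl; exact hx Δ h ha
    exact (hcov a hax).unique ⟨h, ha⟩ ⟨h', ha'⟩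
  rw [h1, Finset.card_erase_of_mem (Finset.mem_univ x), Finset.sum_const_nat hcard, hl,
    Finset.card_univ] at h2
  have : 0 < Fintype.card Ω := Fintype.card_pos_iff.2 ⟨x⟩
  omega

/-- (Lemma 6.6) If the hole stabilizer of a supersimple 2-(n,4,2)
design is transitive on `Ω \ {∞}` and preserves a system of imprimitivity with `ℓ`
blocks of size `k`, then `k ≠ 3`. -/
theorem stmt17 (B : Finset (Finset Ω)) (n : ℕ) (hn : Fintype.card Ω = n)
    (hdes : IsTwoDesign B 2) (hss : HGSupersimple B) (x : Ω)
    (htrans : ∀ a b : Ω, a ≠ x → b ≠ x → ∃ g ∈ holeStab B x, g a = b)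
    (P : Finset (Finset Ω)) (k ℓ : ℕ) (hP : IsHoleBlockSystem B x P k ℓ) :
    k ≠ 3 := by
  rintro rfl
  have hc := hP.card
  have hl := hP.2.2.1
  have D := tripleBlockData hdes hss hP
  have : Nontrivial Ω := Fintype.one_lt_card_iff_nontrivial.1 (by omega)
  obtain ⟨a, ha⟩ := exists_ne x
  obtain h | h | h : ℓ = 2 ∨ ℓ = 3 ∨ 4 ≤ ℓ := by omega
  · exact D.false_of_seven (by omega) ha
  · exact D.false_of_ten (by omega) ha
  · exact D.false_of_thirteen_le (by omega) ha
end
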